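/- Let Φ be a CNF formula with variables x_1,…,x_s (s ≥ 1) and clauses c_1,…,c_t, and let α be a truth assignment of its variables that satisfies exactly q of the clauses. Then the edge-colored graph G_Φ contains a rainbow tree of order 2s+q. -/

import Mathlib

/-!
Edge-colored graph `G_Φ` associated with a CNF formula `Φ` with variables
`x_1, …, x_s` and clauses `c_1, …, c_t`.  Variables are indexed by `0, …, s-1`
and clauses by `0, …, t-1`.  The formula is given by two occurrence relations
`pos` and `neg`: `pos j i` means the positive literal `x_i` occurs in clause
`c_j`, and `neg j i` means the negative literal `¬x_i` occurs in clause `c_j`.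
-/

namespace Stmt0

/-- Vertices of `G_Φ`: `y i`, `a1 i`, `a2 i` for each variable index `i`,
and `cl j` for each clause index `j`. -/
inductive Vtx where
  | y (i : ℕ)
  | a1 (i : ℕ)
  | a2 (i : ℕ)
  | cl (j : ℕ)
deriving DecidableEq

/-- Colors: `b i` and `d i` for variable indices, `C j` for clause indices.
Distinct constructors/indices give pairwise distinct colors. -/
inductive Col where
  | b (i : ℕ)
  | C (j : ℕ)
  | d (i : ℕ)
deriving DecidableEq

/-- The set of edges of `G_Φ` receiving a given color. -/
def colorClass (s t : ℕ) (pos neg : ℕ → ℕ → Prop) : Col → Set (Sym2 Vtx)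
  | .b i => {e | i < s ∧ (e = s(Vtx.y i, Vtx.a1 i) ∨ e = s(Vtx.y i, Vtx.a2 i))}
  | .d i => {e | i + 1 < s ∧ e = s(Vtx.y i, Vtx.y (i + 1))}
  | .C j => {e | j < t ∧ ∃ i < s,
      (pos j i ∧ e = s(Vtx.cl j, Vtx.a1 i)) ∨ (neg j i ∧ e = s(Vtx.cl j, Vtx.a2 i))}

/-- The graph `G_Φ`. -/
def GPhi (s t : ℕ) (pos neg : ℕ → ℕ → Prop) : SimpleGraph Vtx :=
  SimpleGraph.fromEdgeSet (⋃ col, colorClass s t pos neg col)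

/-- A set of edges is rainbow if it contains at most one edge of each color. -/
def Rainbow (s t : ℕ) (pos neg : ℕ → ℕ → Prop) (E : Set (Sym2 Vtx)) : Prop :=
  ∀ col : Col, ∀ e ∈ E, ∀ f ∈ E,
    e ∈ colorClass s t pos neg col → f ∈ colorClass s t pos neg col → e = f

/-- The truth assignment `α` satisfies clause `c_j`. -/
def SatClause (s : ℕ) (pos neg : ℕ → ℕ → Prop) (α : ℕ → Bool) (j : ℕ) : Prop :=
  ∃ i < s, (pos j i ∧ α i = true) ∨ (neg j i ∧ α i = false)

/-- A finite vertex set in which every vertex other than the root `r` has a parent adjacent to it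
and of smaller rank spans a tree whose edges join each non-root vertex to its parent. -/
theorem exists_subgraph_isTree_of_parent {V : Type*} (G : SimpleGraph V) {S : Set V}
    (hS : S.Finite) {r : V} (hr : r ∈ S) (par : V → V) (rank : V → ℕ)
    (hpar : ∀ v ∈ S, v ≠ r → par v ∈ S ∧ G.Adj v (par v) ∧ rank (par v) < rank v) :
    ∃ T : G.Subgraph, T.verts = S ∧ T.coe.IsTree ∧
      ∀ e ∈ T.edgeSet, ∃ v ∈ S, v ≠ r ∧ e = s(v, par v) := by
  classical
  let T : G.Subgraph :=
    { verts := S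
      Adj := fun u v => (u ∈ S ∧ u ≠ r ∧ v = par u) ∨ (v ∈ S ∧ v ≠ r ∧ u = par v)
      adj_sub := by
        rintro u v (⟨h, h', rfl⟩ | ⟨h, h', rfl⟩)
        · exact (hpar u h h').2.1
        · exact (hpar v h h').2.1.symm
      edge_vert := by
        rintro u v (⟨h, h', rfl⟩ | ⟨h, h', rfl⟩)
        · exact h
        · exact (hpar v h h').1
      symm := ⟨fun u v h => h.symm⟩ }
  have : Finite T.verts := hS
  have hreach : ∀ n, ∀ v : T.verts, rank v = n → T.coe.Reachable v ⟨r, hr⟩ := by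
    intro n
    induction n using Nat.strong_induction_on with
    | _ n ih =>
      rintro ⟨v, hv⟩ rfl
      by_cases hvr : v = r
      · subst hvr
        exact SimpleGraph.Reachable.refl _
      · obtain ⟨h1, -, h3⟩ := hpar v hv hvr
        have hadj : T.coe.Adj ⟨v, hv⟩ ⟨par v, h1⟩ := Or.inl ⟨hv, hvr, rfl⟩
        exact hadj.reachable.trans (ih _ h3 ⟨par v, h1⟩ rfl)
  have hconn : T.coe.Connected :=
    { preconnected := fun u v => (hreach _ u rfl).trans (hreach _ v rfl).symm
      nonempty := ⟨⟨r, hr⟩⟩ }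
  refine ⟨T, rfl, ?_, ?_⟩
  · rw [SimpleGraph.isTree_iff_connected_and_card]
    refine ⟨hconn, le_antisymm ?_ hconn.card_vert_le_card_edgeSet_add_one⟩
    let parent : T.verts → T.verts := fun v =>
      if h : (v : V) = r then v else ⟨par v, (hpar v v.2 h).1⟩
    have hsub : T.coe.edgeSet ⊆ (fun v => s(v, parent v)) '' {v | v ≠ ⟨r, hr⟩} := by
      intro e
      induction e using Sym2.ind with
      | _ u v =>
        rintro (⟨h, h', h''⟩ | ⟨h, h', h''⟩)
        · refine ⟨u, fun hu => h' (congrArg Subtype.val hu), ?_⟩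
          have : parent u = v := by
            apply Subtype.ext
            simpa only [parent, dif_neg h'] using h''.symm
          simp only [this]
        · refine ⟨v, fun hv => h' (congrArg Subtype.val hv), ?_⟩
          have : parent v = u := by
            apply Subtype.ext
            simpa only [parent, dif_neg h'] using h''.symm
          simp only [this, Sym2.eq_swap]
    have hcompl : ({v | v ≠ ⟨r, hr⟩} : Set T.verts).ncard + 1 = Nat.card T.verts := by
      have h := Set.ncard_add_ncard_compl ({⟨r, hr⟩} : Set T.verts)
      rw [Set.ncard_singleton, add_comm] at h
      exact h
    rw [← hcompl, Nat.card_coe_set_eq]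
    exact Nat.add_le_add_right
      ((Set.ncard_le_ncard hsub (Set.toFinite _)).trans (Set.ncard_image_le (Set.toFinite _))) 1
  · intro e
    induction e using Sym2.ind with
    | _ u v =>
      rintro (⟨h, h', h''⟩ | ⟨h, h', h''⟩)
      · exact ⟨u, h, h', congrArg (s(u, ·)) h''⟩
      · exact ⟨v, h, h', Sym2.eq_swap.trans (congrArg (s(v, ·)) h'')⟩

/-- The vertex of the literal of `x_i` made true by `α`. -/
def trueLit (α : ℕ → Bool) (i : ℕ) : Vtx :=
  if α i = true then .a1 i else .a2 i

/-- The parent map of the tree: the `y`-path is rooted at `y 0`, literal vertices hang below the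
`y`-path, and the clause vertex `cl j` hangs below the true literal of the variable `f j`. -/
def treeParent (α : ℕ → Bool) (f : ℕ → ℕ) : Vtx → Vtx
  | .y i => .y (i - 1)
  | .a1 i => .y i
  | .a2 i => .y i
  | .cl j => trueLit α (f j)

/-- A rank decreasing along `treeParent`. -/
def treeRank (s : ℕ) : Vtx → ℕ
  | .y i => i
  | .a1 i => i + 1
  | .a2 i => i + 1
  | .cl _ => s + 1

/-- The path vertices, the true literals, and the clause vertices indexed by `J`. -/
def treeVerts (s : ℕ) (α : ℕ → Bool) (J : Set ℕ) : Set Vtx :=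
  (Vtx.y '' Set.Iio s ∪ trueLit α '' Set.Iio s) ∪ Vtx.cl '' J

theorem trueLit_injective (α : ℕ → Bool) : Function.Injective (trueLit α) := by
  intro i k h
  unfold trueLit at h
  split_ifs at h <;> simpa using h

theorem ncard_treeVerts (s : ℕ) (α : ℕ → Bool) {J : Set ℕ} (hJ : J.Finite) :
    (treeVerts s α J).ncard = 2 * s + J.ncard := by
  have hI : (Set.Iio s).ncard = s := by
    rw [← Finset.coe_Iio, Set.ncard_coe_finset, Nat.card_Iio]
  have hy : (Vtx.y '' Set.Iio s).Finite := (Set.finite_Iio s).image _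
  have hl : (trueLit α '' Set.Iio s).Finite := (Set.finite_Iio s).image _
  rw [treeVerts, Set.ncard_union_eq ?_ (hy.union hl) (hJ.image _), Set.ncard_union_eq ?_ hy hl,
    Set.ncard_image_of_injective _ fun _ _ h => Vtx.y.inj h,
    Set.ncard_image_of_injective _ (trueLit_injective α),
    Set.ncard_image_of_injective _ fun _ _ h => Vtx.cl.inj h, hI]
  · ring
  · rw [Set.disjoint_left]
    rintro _ ⟨i, -, rfl⟩ ⟨k, -, h⟩
    unfold trueLit at h
    split_ifs at h
  · rw [Set.disjoint_left]
    rintro _ (⟨i, -, rfl⟩ | ⟨i, -, rfl⟩) ⟨k, -, h⟩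
    · cases h
    · unfold trueLit at h
      split_ifs at h

theorem adj_of_mem_colorClass {s t : ℕ} {pos neg : ℕ → ℕ → Prop} {u v : Vtx} (col : Col)
    (h : s(u, v) ∈ colorClass s t pos neg col) (huv : u ≠ v) : (GPhi s t pos neg).Adj u v :=
  (SimpleGraph.fromEdgeSet_adj _).2 ⟨Set.mem_iUnion.2 ⟨col, h⟩, huv⟩

/-- The color of the edge of the tree joining a vertex to its parent. -/
def parentColor : Vtx → Col
  | .y i => .d (i - 1)
  | .a1 i => .b i
  | .a2 i => .b i
  | .cl j => .C j

/-- Every edge of the graph has only one color, so a tree edge has the color `parentColor`. -/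
theorem eq_parentColor {s t : ℕ} {pos neg : ℕ → ℕ → Prop} {α : ℕ → Bool} {f : ℕ → ℕ} {v : Vtx}
    (hv : v ≠ .y 0) {col : Col}
    (h : s(v, treeParent α f v) ∈ colorClass s t pos neg col) : col = parentColor v := by
  cases v <;> cases col <;> simp only [treeParent, trueLit, colorClass, parentColor] at * <;>
    (try split_ifs at h) <;> simp at * <;> grind

theorem parentColor_injOn (s : ℕ) (α : ℕ → Bool) (J : Set ℕ) :
    Set.InjOn parentColor (treeVerts s α J \ {.y 0}) := by
  rintro u ⟨hu, hu0⟩ v ⟨hv, hv0⟩ h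
  cases u <;> cases v <;> simp [treeVerts, trueLit, parentColor] at * <;> grind

/-- If the truth assignment `α` satisfies exactly `q` of the `t` clauses of `Φ`,
then `G_Φ` contains a rainbow tree of order `2s + q`. -/
theorem rainbow_tree_of_assignment (s t : ℕ) (hs : 1 ≤ s) (pos neg : ℕ → ℕ → Prop)
    (α : ℕ → Bool) (q : ℕ)
    (hq : {j | j < t ∧ SatClause s pos neg α j}.ncard = q) :
    ∃ T : (GPhi s t pos neg).Subgraph,
      T.coe.IsTree ∧ Rainbow s t pos neg T.edgeSet ∧ T.verts.ncard = 2 * s + q := by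
  obtain ⟨f, hf⟩ : ∃ f : ℕ → ℕ, ∀ j, SatClause s pos neg α j →
      f j < s ∧ ((pos j (f j) ∧ α (f j) = true) ∨ (neg j (f j) ∧ α (f j) = false)) := by
    have h : ∀ j, ∃ i, SatClause s pos neg α j →
        i < s ∧ ((pos j i ∧ α i = true) ∨ (neg j i ∧ α i = false)) := by
      intro j
      by_cases hj : SatClause s pos neg α j
      · obtain ⟨i, hi⟩ := hj
        exact ⟨i, fun _ => hi⟩
      · exact ⟨0, fun h => absurd h hj⟩
    choose f hf using h
    exact ⟨f, hf⟩
  set J : Set ℕ := {j | j < t ∧ SatClause s pos neg α j} with hJdef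
  have hJ : J.Finite := (Set.finite_Iio t).subset fun j hj => hj.1
  have hS : (treeVerts s α J).Finite :=
    (((Set.finite_Iio s).image _).union ((Set.finite_Iio s).image _)).union (hJ.image _)
  obtain ⟨T, hT, htree, hE⟩ := exists_subgraph_isTree_of_parent (GPhi s t pos neg) hS
    (r := .y 0) (Or.inl (Or.inl ⟨0, hs, rfl⟩)) (treeParent α f) (treeRank s) (by
      rintro _ ((⟨i, hi, rfl⟩ | ⟨i, hi, rfl⟩) | ⟨j, hj, rfl⟩) hv
      · obtain ⟨k, rfl⟩ : ∃ k, i = k + 1 := Nat.exists_eq_succ_of_ne_zero fun h => hv (h ▸ rfl)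
        have hk : k + 1 < s := hi
        refine ⟨Or.inl (Or.inl ⟨k, Nat.lt_of_succ_lt hk, rfl⟩), ?_, Nat.lt_succ_self k⟩
        exact adj_of_mem_colorClass (.d k) ⟨hk, Sym2.eq_swap⟩ (by simp [treeParent])
      · have hp : treeParent α f (trueLit α i) = .y i := by
          unfold trueLit; split_ifs <;> rfl
        rw [hp]
        refine ⟨Or.inl (Or.inl ⟨i, hi, rfl⟩), adj_of_mem_colorClass (.b i) ⟨hi, ?_⟩ ?_, ?_⟩ <;>
          unfold trueLit <;> split_ifs <;> simp [treeRank, Sym2.eq_swap]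
      · obtain ⟨hlt, hlit⟩ := hf j hj.2
        refine ⟨Or.inl (Or.inr ⟨f j, hlt, rfl⟩),
          adj_of_mem_colorClass (.C j) ⟨hj.1, f j, hlt, ?_⟩ ?_, ?_⟩ <;>
          rcases hlit with ⟨h, hα⟩ | ⟨h, hα⟩ <;> simp [treeParent, trueLit, treeRank, hα, h, hlt])
  refine ⟨T, htree, ?_, by rw [hT, ncard_treeVerts s α hJ, hq]⟩
  intro col e he e' he' hc hc'
  obtain ⟨u, hu, hu0, rfl⟩ := hE e he
  obtain ⟨v, hv, hv0, rfl⟩ := hE e' he'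
  rw [parentColor_injOn s α J ⟨hu, hu0⟩ ⟨hv, hv0⟩
    ((eq_parentColor hu0 hc).symm.trans (eq_parentColor hv0 hc'))]

end Stmt0
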